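/- Let l, p ≥ 1 with lp ≥ 2 and set N = lp. For every i with 1 ≤ i ≤ N, the formal partial derivative of the Δ-polynomial with respect to t_i satisfies ∂Δ_{l,p}(q_1,…,q_N,t_1,…,t_N)/∂t_i = P_{N−1}(q_{i+1}, …, q_N, q_1, …, q_{i−1}, t_{i+1}, …, t_N, t_1, …, t_{i−1}), the generalized Chebyshev polynomial in the cyclically permuted variables omitting q_i and t_i. -/

import Mathlib

noncomputable section

/-- The quantized generalized Chebyshev polynomials, evaluated in any commutative
ring: `genCheb n q t` is `P_n(q_1,…,q_n,t_1,…,t_n)` (indices are 1-based), defined by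
`P_0 = 1`, `P_1 = t_1`, `P_n = t_n·P_{n-1} - q_n·P_{n-2}`. -/
def genCheb {R : Type*} [CommRing R] : ℕ → (ℕ → R) → (ℕ → R) → R
  | 0, _, _ => 1
  | 1, _, t => t 1
  | n + 2, q, t => t (n + 2) * genCheb (n + 1) q t - q (n + 2) * genCheb n q t

/-- The Δ-polynomial:
`Δ(N; q, t) = P_N(q_1,…,q_N,t_1,…,t_N) - q_1·P_{N-2}(q_2,…,q_{N-1},t_2,…,t_{N-1})`. -/
def Delta {R : Type*} [CommRing R] (N : ℕ) (q t : ℕ → R) : R :=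
  genCheb N q t - q 1 * genCheb (N - 2) (fun j => q (1 + j)) (fun j => t (1 + j))

/-- The variable `q_i` in `ℤ[q_1,q_2,…,t_1,t_2,…]`. -/
def Qv (i : ℕ) : MvPolynomial (ℕ ⊕ ℕ) ℤ := MvPolynomial.X (Sum.inl i)

/-- The variable `t_i` in `ℤ[q_1,q_2,…,t_1,t_2,…]`. -/
def Tv (i : ℕ) : MvPolynomial (ℕ ⊕ ℕ) ℤ := MvPolynomial.X (Sum.inr i)

section

variable {R : Type*} [CommRing R]

/-- `genCheb n q t` depends only on the values of `q` and `t` on `1, …, n`. -/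
theorem genCheb_congr {q q' t t' : ℕ → R} (n : ℕ) (hq : ∀ j, 1 ≤ j → j ≤ n → q j = q' j)
    (ht : ∀ j, 1 ≤ j → j ≤ n → t j = t' j) : genCheb n q t = genCheb n q' t' := by
  induction n using Nat.twoStepInduction with
  | zero => rfl
  | one => exact ht 1 le_rfl le_rfl
  | more n ih ih' =>
    rw [genCheb, genCheb, ht (n + 2) (by omega) le_rfl, hq (n + 2) (by omega) le_rfl,
      ih (fun j h h' => hq j h (by omega)) (fun j h h' => ht j h (by omega)),
      ih' (fun j h h' => hq j h (by omega)) (fun j h h' => ht j h (by omega))]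

/-- Splitting a generalized Chebyshev polynomial at the link between `m + 1` and `m + 2`. -/
theorem genCheb_add (m n : ℕ) (q t : ℕ → R) :
    genCheb (m + n + 2) q t =
      genCheb (m + 1) q t *
          genCheb (n + 1) (fun j => q (m + 1 + j)) (fun j => t (m + 1 + j)) -
        q (m + 2) * genCheb m q t *
          genCheb n (fun j => q (m + 2 + j)) (fun j => t (m + 2 + j)) := by
  induction n using Nat.twoStepInduction with
  | zero =>
    simp only [genCheb]
    ring_nf
  | one =>
    simp only [genCheb, show m + 1 + 2 = m + 3 by omega, show m + 1 + 1 = m + 2 by omega]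
    ring_nf
  | more n ih ih' =>
    rw [show m + (n + 2) + 2 = m + n + 2 + 2 by omega, genCheb, ih,
      show m + n + 2 + 1 = m + (n + 1) + 2 by omega, ih',
      show n + 2 + 1 = n + 1 + 2 by omega, genCheb.eq_3 _ _ (n + 1),
      genCheb.eq_3 (fun j => q (m + 2 + j))]
    simp only [show m + 1 + (n + 1 + 2) = m + n + 2 + 2 by omega,
      show m + 2 + (n + 2) = m + n + 2 + 2 by omega]
    ring

theorem Derivation.genCheb_eq_zero {A : Type*} [CommRing A] [Algebra A R] (D : Derivation A R R)
    {q t : ℕ → R} (hq : ∀ j, D (q j) = 0) (n : ℕ) (ht : ∀ j, 1 ≤ j → j ≤ n → D (t j) = 0) :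
    D (genCheb n q t) = 0 := by
  induction n using Nat.twoStepInduction with
  | zero => simp [genCheb]
  | one => exact ht 1 le_rfl le_rfl
  | more n ih ih' =>
    simp [genCheb, hq, ht (n + 2) (by omega) le_rfl, ih fun j h h' => ht j h (by omega),
      ih' fun j h h' => ht j h (by omega)]

/-- Differentiating with respect to `t_{k+1}` splits the polynomial into the two parts
on either side of `k + 1`. -/
theorem Derivation.genCheb_eq_mul {A : Type*} [CommRing A] [Algebra A R] (D : Derivation A R R)
    {q t : ℕ → R} (hq : ∀ j, D (q j) = 0) (k m : ℕ) (hk : D (t (k + 1)) = 1)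
    (ht : ∀ j, j ≠ k + 1 → D (t j) = 0) :
    D (genCheb (k + 1 + m) q t) =
      genCheb k q t * genCheb m (fun j => q (k + 1 + j)) (fun j => t (k + 1 + j)) := by
  have hlt (n : ℕ) (hn : n ≤ k) : D (genCheb n q t) = 0 :=
    D.genCheb_eq_zero hq n fun j _ _ => ht j (by omega)
  have hself : D (genCheb (k + 1) q t) = genCheb k q t := by
    cases k with
    | zero => simpa [genCheb] using hk
    | succ k => simp [genCheb, hq, hk, hlt (k + 1) le_rfl, hlt k (by omega)]
  induction m using Nat.twoStepInduction with
  | zero => simp [genCheb, hself]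
  | one =>
    simp [genCheb, hq, hself, hlt k le_rfl, ht (k + 2) (by omega), mul_comm, add_assoc]
  | more m ih ih' =>
    rw [← add_assoc, genCheb, add_assoc (k + 1) m 1, map_sub, D.leibniz, D.leibniz, ih, ih', hq,
      ht (k + 1 + m + 2) (by omega), genCheb, ← add_assoc]
    simp only [smul_eq_mul]
    ring_nf

end

theorem pderiv_inr_Qv (i j : ℕ) : MvPolynomial.pderiv (Sum.inr i) (Qv j) = 0 :=
  MvPolynomial.pderiv_X_of_ne (by simp)

theorem pderiv_inr_Tv_self (i : ℕ) : MvPolynomial.pderiv (Sum.inr i) (Tv i) = 1 :=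
  MvPolynomial.pderiv_X_self _

theorem pderiv_inr_Tv_of_ne {i j : ℕ} (h : j ≠ i) :
    MvPolynomial.pderiv (Sum.inr i) (Tv j) = 0 :=
  MvPolynomial.pderiv_X_of_ne (by simpa using h)

/-- For `N = l·p ≥ 2` and `1 ≤ i ≤ N`,
`∂Δ_{l,p}/∂t_i = P_{N-1}(q_{i+1},…,q_N,q_1,…,q_{i-1},t_{i+1},…,t_N,t_1,…,t_{i-1})`,
the generalized Chebyshev polynomial in the cyclically permuted variables
omitting `q_i` and `t_i`. -/
theorem pderiv_Delta (l p : ℕ) (hl : 1 ≤ l) (hp : 1 ≤ p) (hN : 2 ≤ l * p)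
    (i : ℕ) (hi1 : 1 ≤ i) (hiN : i ≤ l * p) :
    MvPolynomial.pderiv (Sum.inr i) (Delta (l * p) Qv Tv) =
      genCheb (l * p - 1)
        (fun j => Qv (if i + j ≤ l * p then i + j else i + j - l * p))
        (fun j => Tv (if i + j ≤ l * p then i + j else i + j - l * p)) := by
  generalize l * p = N at hN hiN ⊢
  obtain ⟨k, rfl⟩ : ∃ k, i = k + 1 := ⟨i - 1, by omega⟩
  obtain ⟨m, rfl⟩ : ∃ m, N = k + 1 + m := ⟨N - (k + 1), by omega⟩
  have hfst := (MvPolynomial.pderiv (R := ℤ) (Sum.inr (k + 1))).genCheb_eq_mul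
    (pderiv_inr_Qv (k + 1)) k m (pderiv_inr_Tv_self (k + 1)) fun _ => pderiv_inr_Tv_of_ne
  simp only [Delta, map_sub, Derivation.leibniz, smul_eq_mul, pderiv_inr_Qv, mul_zero, add_zero,
    hfst]
  rcases k with _ | k
  · rw [Derivation.genCheb_eq_zero _ (fun j => pderiv_inr_Qv _ _) _
      fun j _ _ => pderiv_inr_Tv_of_ne (by omega), mul_zero, sub_zero, genCheb, one_mul,
      show 0 + 1 + m - 1 = m by omega]
    refine genCheb_congr m (fun j _ _ => ?_) fun j _ _ => ?_ <;> rw [if_pos (by omega)]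
  rcases m with _ | m
  · rw [Derivation.genCheb_eq_zero _ (fun j => pderiv_inr_Qv _ _) _
      fun j _ _ => pderiv_inr_Tv_of_ne (by omega), mul_zero, sub_zero, genCheb, mul_one,
      show k + 1 + 1 + 0 - 1 = k + 1 by omega]
    refine genCheb_congr (k + 1) (fun j _ _ => ?_) fun j _ _ => ?_ <;>
      rw [if_neg (by omega)] <;> congr 1 <;> omega
  · have hsnd := (MvPolynomial.pderiv (R := ℤ) (Sum.inr (k + 1 + 1))).genCheb_eq_mul
      (q := fun j => Qv (1 + j)) (t := fun j => Tv (1 + j)) (fun j => pderiv_inr_Qv _ _) k m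
      (by rw [add_comm 1]; exact pderiv_inr_Tv_self _)
      fun j hj => pderiv_inr_Tv_of_ne (by omega)
    rw [show k + 1 + 1 + (m + 1) - 2 = k + 1 + m by omega, hsnd,
      show k + 1 + 1 + (m + 1) - 1 = m + k + 2 by omega]
    set r : ℕ → ℕ := fun j => if k + 1 + 1 + j ≤ k + 1 + 1 + (m + 1) then k + 1 + 1 + j
      else k + 1 + 1 + j - (k + 1 + 1 + (m + 1))
    have hlow (j : ℕ) (hj : j ≤ m + 1) : r j = k + 1 + 1 + j := if_pos (by omega)
    have hhigh (j : ℕ) (hj : 1 ≤ j) : r (m + 1 + j) = j := (if_neg (by omega)).trans (by omega)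
    have hleft (n : ℕ) (hn : n ≤ m + 1) :
        genCheb n (fun j => Qv (r j)) (fun j => Tv (r j)) =
          genCheb n (fun j => Qv (k + 1 + 1 + j)) (fun j => Tv (k + 1 + 1 + j)) :=
      genCheb_congr n (fun j _ _ => by rw [hlow j (by omega)])
        fun j _ _ => by rw [hlow j (by omega)]
    have hright : genCheb (k + 1) (fun j => Qv (r (m + 1 + j))) (fun j => Tv (r (m + 1 + j))) =
        genCheb (k + 1) Qv Tv :=
      genCheb_congr _ (fun j hj _ => by rw [hhigh j hj]) fun j hj _ => by rw [hhigh j hj]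
    have hhigh' (j : ℕ) : r (m + 2 + j) = 1 + j := by
      rw [show m + 2 + j = m + 1 + (1 + j) by omega, hhigh _ (by omega)]
    change _ = genCheb (m + k + 2) (fun j => Qv (r j)) (fun j => Tv (r j))
    rw [genCheb_add, hleft _ le_rfl, hleft m (by omega), hright, hhigh' 0]
    simp only [hhigh', show ∀ j, 1 + (k + 1 + j) = k + 1 + 1 + j by omega]
    ring
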